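/- For every t ∈ (0,1) and every integer k ≥ 1, the point (1 − 1/(2k))·e^{2πi/k} belongs to Ω_t if and only if d_k(t) = 1. Consequently, the map t ↦ Ω_t is injective on (0,1): if t, t' ∈ (0,1) satisfy Ω_t = Ω_{t'}, then t = t'. -/

import Mathlib

open Filter Metric Topology

noncomputable section

/-- The radial spoke `L_k = {r·e^{2πi/k} : r ∈ [1 − 1/k, 1]}`. -/
def L (k : ℕ) : Set ℂ :=
  {z : ℂ | ∃ r : ℝ, r ∈ Set.Icc (1 - 1 / (k : ℝ)) 1 ∧
    z = (r : ℂ) * Complex.exp (2 * Real.pi * Complex.I / k)}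

/-- The set `Ω_S`: the unit circle together with the spokes `L_k` for `k ∈ S`. -/
def Om (S : Set ℕ) : Set ℂ := Metric.sphere (0 : ℂ) 1 ∪ ⋃ k ∈ S, L k

/-- The `k`-th binary digit of `t` (terminating expansion for dyadic rationals). -/
def digit (k : ℕ) (t : ℝ) : ℤ := ⌊(2 : ℝ) ^ k * t⌋ % 2

/-- The set of positions `k ≥ 1` where the binary expansion of `t` has digit `1`. -/
def Sdig (t : ℝ) : Set ℕ := {k : ℕ | 1 ≤ k ∧ digit k t = 1}

/-- The set `Ω_t` for `t ∈ (0,1)`, built from the binary digits of `t`. -/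
def OmT (t : ℝ) : Set ℂ := Om (Sdig t)

theorem exp_two_pi_I_div_injective {j k : ℕ} (hj : 1 ≤ j) (hk : 1 ≤ k)
    (h : Complex.exp (2 * Real.pi * Complex.I / j) = Complex.exp (2 * Real.pi * Complex.I / k)) :
    j = k := by
  obtain ⟨n, hn⟩ := Complex.exp_eq_exp_iff_exists_int.mp h
  have hj0 : (0 : ℝ) < j := by exact_mod_cast hj
  have hk0 : (0 : ℝ) < k := by exact_mod_cast hk
  have hinv : (j : ℝ)⁻¹ = (k : ℝ)⁻¹ + n := by
    have : (2 * Real.pi * Complex.I) * (j : ℂ)⁻¹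
        = (2 * Real.pi * Complex.I) * ((k : ℂ)⁻¹ + n) := by
      linear_combination hn
    have := mul_left_cancel₀ Complex.two_pi_I_ne_zero this
    apply Complex.ofReal_injective
    push_cast
    exact this
  have hj1 : (j : ℝ)⁻¹ ≤ 1 := inv_le_one_of_one_le₀ (by exact_mod_cast hj)
  have hk1 : (k : ℝ)⁻¹ ≤ 1 := inv_le_one_of_one_le₀ (by exact_mod_cast hk)
  have hj2 := inv_pos.mpr hj0
  have hk2 := inv_pos.mpr hk0
  have hn1 : n < 1 := by
    have : (n : ℝ) < 1 := by linarith
    exact_mod_cast this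
  have hn2 : -1 < n := by
    have : (-1 : ℝ) < n := by linarith
    exact_mod_cast this
  obtain rfl : n = 0 := by omega
  simpa using hinv

theorem norm_exp_two_pi_I_div (k : ℕ) :
    ‖Complex.exp (2 * Real.pi * Complex.I / k)‖ = 1 := by
  simp [Complex.norm_exp, Complex.div_natCast_re]

/-- The midpoint of a spoke lies on no other spoke and not on the circle. -/
theorem midpoint_mem_Om_iff {S : Set ℕ} (hS : ∀ j ∈ S, 1 ≤ j) {k : ℕ} (hk : 1 ≤ k) :
    ((1 - 1 / (2 * (k : ℝ)) : ℝ) : ℂ) * Complex.exp (2 * Real.pi * Complex.I / k) ∈ Om S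
      ↔ k ∈ S := by
  have hk1 : (1 : ℝ) ≤ k := by exact_mod_cast hk
  have hpos : 0 < 1 / (2 * (k : ℝ)) := by positivity
  have hhalf : 1 / (2 * (k : ℝ)) < 1 := by
    rw [div_lt_one (by positivity)]; linarith
  have hle : 1 / (2 * (k : ℝ)) ≤ 1 / k := by
    gcongr; linarith
  constructor
  · rintro (h | h)
    · rw [mem_sphere_zero_iff_norm, norm_mul, norm_exp_two_pi_I_div, Complex.norm_real,
        Real.norm_of_nonneg (by linarith)] at h
      linarith
    · simp only [Set.mem_iUnion] at h
      obtain ⟨j, hj, r, ⟨hr, -⟩, heq⟩ := h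
      have hj1 : 1 / (j : ℝ) ≤ 1 := by
        rw [one_div]
        exact inv_le_one_of_one_le₀ (by exact_mod_cast hS j hj)
      have hnorm := congrArg norm heq
      rw [norm_mul, norm_mul, norm_exp_two_pi_I_div, norm_exp_two_pi_I_div, Complex.norm_real,
        Complex.norm_real, Real.norm_of_nonneg (by linarith), Real.norm_of_nonneg (by linarith),
        mul_one, mul_one] at hnorm
      rw [← hnorm] at heq
      have hne : ((1 - 1 / (2 * (k : ℝ)) : ℝ) : ℂ) ≠ 0 := by
        rw [Complex.ofReal_ne_zero]; linarith
      rwa [exp_two_pi_I_div_injective hk (hS j hj) (mul_left_cancel₀ hne heq)]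
  · intro h
    refine Or.inr (Set.mem_biUnion h ⟨_, ⟨?_, ?_⟩, rfl⟩) <;> linarith

theorem floor_two_pow_succ_mul (k : ℕ) (t : ℝ) :
    ⌊(2 : ℝ) ^ (k + 1) * t⌋ = 2 * ⌊(2 : ℝ) ^ k * t⌋ + digit (k + 1) t := by
  have h : ⌊(2 : ℝ) ^ (k + 1) * t⌋ / 2 = ⌊(2 : ℝ) ^ k * t⌋ := by
    have := Int.floor_div_natCast ((2 : ℝ) ^ (k + 1) * t) 2
    rw [Nat.cast_ofNat, Nat.cast_ofNat] at this
    rw [← this]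
    congr 1
    ring
  rw [← h, digit, Int.mul_ediv_add_emod]

theorem eq_of_digit_eq {t t' : ℝ} (h0 : ⌊t⌋ = ⌊t'⌋)
    (h : ∀ k : ℕ, 1 ≤ k → digit k t = digit k t') : t = t' := by
  have hfloor (k : ℕ) : ⌊(2 : ℝ) ^ k * t⌋ = ⌊(2 : ℝ) ^ k * t'⌋ := by
    induction k with
    | zero => simpa using h0
    | succ k ih => rw [floor_two_pow_succ_mul, floor_two_pow_succ_mul, ih, h _ (by omega)]
  by_contra hne
  have hpos : 0 < |t - t'| := abs_pos.mpr (sub_ne_zero.mpr hne)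
  obtain ⟨n, hn⟩ := pow_unbounded_of_one_lt (|t - t'|)⁻¹ (one_lt_two (α := ℝ))
  have hlt := Int.abs_sub_lt_one_of_floor_eq_floor (hfloor n)
  rw [← mul_sub, abs_mul, abs_of_pos (by positivity : (0 : ℝ) < 2 ^ n)] at hlt
  rw [inv_lt_iff_one_lt_mul₀ hpos] at hn
  linarith

/-- The midpoint of the spoke `L_k` lies in `Ω_t` iff the `k`-th digit of `t` is `1`;
consequently `t ↦ Ω_t` is injective on `(0,1)`. -/
theorem OmT_detects_digits_and_injective :
    (∀ t ∈ Set.Ioo (0 : ℝ) 1, ∀ k : ℕ, 1 ≤ k →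
      (((1 - 1 / (2 * (k : ℝ)) : ℝ) : ℂ) * Complex.exp (2 * Real.pi * Complex.I / k) ∈ OmT t
        ↔ digit k t = 1)) ∧
    ∀ t ∈ Set.Ioo (0 : ℝ) 1, ∀ t' ∈ Set.Ioo (0 : ℝ) 1, OmT t = OmT t' → t = t' := by
  have hmem (t : ℝ) (k : ℕ) (hk : 1 ≤ k) :
      ((1 - 1 / (2 * (k : ℝ)) : ℝ) : ℂ) * Complex.exp (2 * Real.pi * Complex.I / k) ∈ OmT t
        ↔ digit k t = 1 :=
    (midpoint_mem_Om_iff (fun _ hj => hj.1) hk).trans (and_iff_right hk)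
  refine ⟨fun t _ => hmem t, fun t ht t' ht' h => eq_of_digit_eq ?_ fun k hk => ?_⟩
  · rw [Int.floor_eq_zero_iff.mpr ⟨ht.1.le, ht.2⟩, Int.floor_eq_zero_iff.mpr ⟨ht'.1.le, ht'.2⟩]
  · have hiff : digit k t = 1 ↔ digit k t' = 1 := by rw [← hmem t k hk, h, hmem t' k hk]
    unfold digit at hiff ⊢
    omega
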